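/- arXiv:2003.09138 — 4 statements merged into one kernel-verified Lean document; each statement's English description precedes it below -/
import Mathlib

section
/- Let φ be a Γ-semi-equivariant (G,θ)-valued transition cocycle over a cover U = {U_a}_{a∈A} of a left Γ-set X. On the disjoint union ⨆_{a∈A} {a} × U_a × G define (a,x,g) ~ (b,x,φ_{ba}(1,x)·g) for x ∈ U_a ∩ U_b. Then: (i) ~ is an equivalence relation; (ii) the formula γ·[a,x,g] := [b, γ·x, φ_{ba}(γ,x)·(γ·g)], for any b with γ·x ∈ U_b, is independent of the representative (a,x,g) and of the choice of b, and defines a left Γ-action on the quotient P^φ (so 1·q = q and γ′·(γ·q) = (γ′γ)·q); (iii) with the right G-action [a,x,g]·g′ := [a,x,gg′] and projection π[a,x,g] := x, P^φ is a Γ-semi-equivariant principal (G,θ)-bundle: π is a surjection onto X, G acts freely and transitively on each fiber, π(γ·q) = γ·π(q), and γ·(q·g) = (γ·q)·(γ·g). -/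
namespace SemiDD

/-- Extend a finite tuple by `1` outside its range. -/
def ext {G : Type*} [One G] {n : ℕ} (f : Fin n → G) (m : ℕ) : G :=
  if h : m < n then f ⟨m, h⟩ else 1

/-- The face maps `d_i : X^{p+1} → X^p` of the simplicial space `X^• = {Γ^p × X}`. -/
def face {Γ X : Type*} [Group Γ] [MulAction Γ X] {p : ℕ} (i : ℕ)
    (z : (Fin (p + 1) → Γ) × X) : (Fin p → Γ) × X :=
  (fun k => if (k : ℕ) + 1 < i then ext z.1 (k : ℕ)
    else if (k : ℕ) + 1 = i then ext z.1 (k : ℕ) * ext z.1 ((k : ℕ) + 1)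
    else ext z.1 ((k : ℕ) + 1),
   if i = p + 1 then ext z.1 p • z.2 else z.2)

/-- The degeneracy maps `e_i : X^p → X^{p+1}` of the simplicial space. -/
def degen {Γ X : Type*} [One Γ] {p : ℕ} (i : ℕ)
    (z : (Fin p → Γ) × X) : (Fin (p + 1) → Γ) × X :=
  (fun k => if (k : ℕ) < i then ext z.1 (k : ℕ)
    else if (k : ℕ) = i then 1
    else ext z.1 ((k : ℕ) - 1), z.2)

/-- The simplicial twisting maps `θ_i^{x^p} : G → G`: `θ_0^{(γ_1,…,γ_p,x)} = θ_{γ_1}`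
and `θ_i = id` for `i ≥ 1`. -/
def twist {Γ G : Type*} [Group Γ] [Group G] [MulDistribMulAction Γ G]
    {X : Type*} {p : ℕ} (i : ℕ) (z : (Fin p → Γ) × X) (g : G) : G :=
  if i = 0 then ext z.1 0 • g else g

/-- The point `x^p_i = γ_{i+1}⋯γ_p • x` associated to `x^p = (γ_1,…,γ_p,x) ∈ X^p`. -/
def pt {Γ X : Type*} [Group Γ] [MulAction Γ X] {p : ℕ}
    (z : (Fin p → Γ) × X) (i : ℕ) : X :=
  (((List.range p).drop i).map (ext z.1)).prod • z.2

/-- The subset `U_{(a_0,…,a_p)} ⊆ X^p` of the simplicial cover. -/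
def tupSet {Γ X ι : Type*} [Group Γ] [MulAction Γ X] (U : ι → Set X)
    {p : ℕ} (a : Fin (p + 1) → ι) : Set ((Fin p → Γ) × X) :=
  {z | ∀ i : Fin (p + 1), pt z (i : ℕ) ∈ U (a i)}

/-- The face map on index tuples: delete the `i`-th entry. -/
def faceIdx {ι : Type*} {n : ℕ} (i : ℕ) (a : Fin (n + 1) → ι) : Fin n → ι :=
  fun k => if (k : ℕ) < i then a k.castSucc else a k.succ

/-- The group `K^p_Γ(U,X,(G,θ))` of `p`-cochains. -/
abbrev K (Γ : Type*) {X ι : Type*} [Group Γ] [MulAction Γ X]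
    (U : ι → Set X) (G : Type*) [Group G] (p : ℕ) :=
  ∀ a : Fin (p + 1) → ι, tupSet (Γ := Γ) U a → G

open Classical in
/-- The twisted pullback maps `δ_i : K^p → K^{p+1}`. -/
noncomputable def tpb {Γ X ι G : Type*} [Group Γ] [MulAction Γ X] [Group G]
    [MulDistribMulAction Γ G] {U : ι → Set X} {p : ℕ} (i : ℕ)
    (φ : K Γ U G p) : K Γ U G (p + 1) :=
  fun a z =>
    twist i z.1
      (if h : face i z.1 ∈ tupSet (Γ := Γ) U (faceIdx i a) then
        φ (faceIdx i a) ⟨face i z.1, h⟩ else 1)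

/-- The coboundary `∂ = Σ_{i=0}^{p+1} (−1)^i δ_i : K^p → K^{p+1}` (written
multiplicatively, as an ordered product; for abelian coefficients this is the
alternating sum of the twisted pullbacks). -/
noncomputable def cob {Γ X ι G : Type*} [Group Γ] [MulAction Γ X] [Group G]
    [MulDistribMulAction Γ G] {U : ι → Set X} {p : ℕ}
    (φ : K Γ U G p) : K Γ U G (p + 1) :=
  ((List.range (p + 2)).map (fun i => tpb i φ ^ ((-1 : ℤ) ^ i))).prod

/-- The map on cochains induced by a map of coefficient groups. -/
def mapK {Γ X ι : Type*} [Group Γ] [MulAction Γ X] {U : ι → Set X}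
    {A B : Type*} [Group A] [Group B] (f : A → B) {p : ℕ}
    (φ : K Γ U A p) : K Γ U B p :=
  fun a z => f (φ a z)

/-- The restriction map on cochains induced by a refinement `r` of covers. -/
def res {Γ X ι κ G : Type*} [Group Γ] [MulAction Γ X] [Group G]
    {U : ι → Set X} {V : κ → Set X} (r : κ → ι)
    (hr : ∀ b, V b ⊆ U (r b)) {p : ℕ} (φ : K Γ U G p) : K Γ V G p :=
  fun b z => φ (fun i => r (b i)) ⟨z.1, fun i => hr (b i) (z.2 i)⟩

/-- A `Γ`-semi-equivariant (G,θ)-valued transition cocycle over the cover `U`. -/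
def IsCocycle {Γ X G ι : Type*} [Group Γ] [MulAction Γ X] [Group G]
    [MulDistribMulAction Γ G] (U : ι → Set X) (φ : ι → ι → Γ → X → G) : Prop :=
  (∀ (a : ι) (x : X), x ∈ U a → φ a a 1 x = 1) ∧
  (∀ (γ' γ : Γ) (a b c : ι) (x : X), x ∈ U a → γ • x ∈ U b →
    (γ' * γ) • x ∈ U c →
    φ c a (γ' * γ) x = φ c b γ' (γ • x) * γ' • φ b a γ x)

/-- Set-theoretic data of a `Γ`-semi-equivariant principal `(G,θ)`-bundle over
a left `Γ`-set `X`. -/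
structure SEBundle (Γ X G : Type*) [Group Γ] [MulAction Γ X] [Group G]
    [MulDistribMulAction Γ G] where
  P : Type*
  π : P → X
  surj : Function.Surjective π
  actG : P → G → P
  actG_one : ∀ p, actG p 1 = p
  actG_mul : ∀ p g g', actG (actG p g) g' = actG p (g * g')
  π_actG : ∀ p g, π (actG p g) = π p
  freeTrans : ∀ p q, π p = π q → ∃! g, actG p g = q
  actΓ : Γ → P → P
  actΓ_one : ∀ p, actΓ 1 p = p
  actΓ_mul : ∀ γ' γ p, actΓ γ' (actΓ γ p) = actΓ (γ' * γ) p
  π_actΓ : ∀ γ p, π (actΓ γ p) = γ • π p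
  semi : ∀ γ p g, actΓ γ (actG p g) = actG (actΓ γ p) (γ • g)

/-- The total space `⨆_{a} {a} × U_a × G` used in reconstructing a bundle
from a transition cocycle. -/
def Tot {X ι : Type*} (U : ι → Set X) (G : Type*) :=
  Σ a : ι, (U a) × G

/-- The gluing relation `(a,x,g) ~ (b,x,φ_{ba}(1,x)·g)`. -/
def rel {Γ X G ι : Type*} [One Γ] [Mul G] (U : ι → Set X)
    (φ : ι → ι → Γ → X → G) (z w : Tot U G) : Prop :=
  (z.2.1 : X) = (w.2.1 : X) ∧ w.2.2 = φ w.1 z.1 (1 : Γ) (z.2.1 : X) * z.2.2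

/-- The total space `P^φ` of the bundle reconstructed from a transition
cocycle `φ`. -/
def PB {Γ X G ι : Type*} [One Γ] [Mul G] (U : ι → Set X)
    (φ : ι → ι → Γ → X → G) :=
  Quot (rel U φ)

/-- The projection `π : P^φ → X`, `[a,x,g] ↦ x`. -/
def pbProj {Γ X G ι : Type*} [One Γ] [Mul G] {U : ι → Set X}
    {φ : ι → ι → Γ → X → G} : PB U φ → X :=
  Quot.lift (fun z => (z.2.1 : X)) (fun _ _ h => h.1)

/-- The right `G`-action on `P^φ`, `[a,x,g]·g' = [a,x,g·g']`. -/
def pbActG {Γ X G ι : Type*} [One Γ] [Group G] {U : ι → Set X}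
    {φ : ι → ι → Γ → X → G} (g' : G) : PB U φ → PB U φ :=
  Quot.lift (fun z => Quot.mk (rel U φ) ⟨z.1, ⟨z.2.1, z.2.2 * g'⟩⟩)
    (fun z w h => Quot.sound
      ⟨h.1, show w.2.2 * g' = φ w.1 z.1 (1 : Γ) (z.2.1 : X) * (z.2.2 * g') from
        by rw [h.2, mul_assoc]⟩)

/-- Specification of the left `Γ`-action `γ·[a,x,g] = [b, γ·x, φ_{ba}(γ,x)·(γ·g)]`
on `P^φ`. -/
def pbActSpec {Γ X G ι : Type*} [Group Γ] [MulAction Γ X] [Group G]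
    [MulDistribMulAction Γ G] (U : ι → Set X) (φ : ι → ι → Γ → X → G)
    (act : Γ → PB U φ → PB U φ) : Prop :=
  ∀ (γ : Γ) (a : ι) (x : X) (hx : x ∈ U a) (g : G) (b : ι) (hb : γ • x ∈ U b),
    act γ (Quot.mk (rel U φ) ⟨a, ⟨⟨x, hx⟩, g⟩⟩) =
      Quot.mk (rel U φ) ⟨b, ⟨⟨γ • x, hb⟩, φ b a γ x * γ • g⟩⟩

section PrincipalAction

variable {Γ X G ι : Type*} [One Γ] [Group G] {U : ι → Set X} {φ : ι → ι → Γ → X → G}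

theorem pbProj_surjective (hU : ∀ x : X, ∃ a, x ∈ U a) :
    Function.Surjective (pbProj (U := U) (φ := φ)) := fun x =>
  let ⟨a, ha⟩ := hU x
  ⟨Quot.mk _ ⟨a, ⟨x, ha⟩, 1⟩, rfl⟩

theorem pbActG_one (q : PB U φ) : pbActG (1 : G) q = q := by
  obtain ⟨⟨a, x, g⟩⟩ := q
  exact congrArg (fun k => Quot.mk (rel U φ) ⟨a, x, k⟩) (mul_one g)

theorem pbActG_pbActG (g g' : G) (q : PB U φ) :
    pbActG g' (pbActG g q) = pbActG (g * g') q := by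
  obtain ⟨⟨a, x, k⟩⟩ := q
  exact congrArg (fun k => Quot.mk (rel U φ) ⟨a, x, k⟩) (mul_assoc k g g')

theorem pbProj_pbActG (g : G) (q : PB U φ) : pbProj (pbActG g q) = pbProj q := by
  obtain ⟨z⟩ := q
  rfl

end PrincipalAction

section Reconstruction

variable {Γ X G ι : Type*} [Group Γ] [MulAction Γ X] [Group G] [MulDistribMulAction Γ G]
  {U : ι → Set X} {φ : ι → ι → Γ → X → G}

theorem IsCocycle.one_mul_eq (hφ : IsCocycle U φ) {a b c : ι} {γ : Γ} {x : X}
    (ha : x ∈ U a) (hb : γ • x ∈ U b) (hc : γ • x ∈ U c) :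
    φ c b 1 (γ • x) * φ b a γ x = φ c a γ x := by
  simpa using (hφ.2 1 γ a b c x ha hb (by simpa using hc)).symm

theorem IsCocycle.mul_smul_one_eq (hφ : IsCocycle U φ) {a b c : ι} {γ : Γ} {x : X}
    (ha : x ∈ U a) (hb : x ∈ U b) (hc : γ • x ∈ U c) :
    φ c b γ x * γ • φ b a 1 x = φ c a γ x := by
  simpa using (hφ.2 γ 1 a b c x ha (by simpa using hb) (by simpa using hc)).symm

theorem IsCocycle.one_mul_one_eq (hφ : IsCocycle U φ) {a b c : ι} {x : X}
    (ha : x ∈ U a) (hb : x ∈ U b) (hc : x ∈ U c) :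
    φ c b 1 x * φ b a 1 x = φ c a 1 x := by
  simpa using hφ.mul_smul_one_eq (γ := 1) ha hb (by simpa using hc)

theorem IsCocycle.equivalence_rel (hφ : IsCocycle U φ) : Equivalence (rel U φ) where
  refl := fun ⟨a, ⟨x, hx⟩, g⟩ => ⟨rfl, by simp [hφ.1 a x hx]⟩
  symm := by
    rintro ⟨a, ⟨x, ha⟩, g⟩ ⟨b, ⟨y, hb⟩, h⟩ ⟨hxy, hgh⟩
    dsimp only at hxy hgh
    subst hxy hgh
    exact ⟨rfl, by simp [← mul_assoc, hφ.one_mul_one_eq ha hb ha, hφ.1 a x ha]⟩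
  trans := by
    rintro ⟨a, ⟨x, ha⟩, g⟩ ⟨b, ⟨y, hb⟩, h⟩ ⟨c, ⟨z, hc⟩, k⟩ ⟨hxy, hgh⟩ ⟨hyz, hhk⟩
    dsimp only at hxy hgh hyz hhk
    subst hxy hgh hyz hhk
    exact ⟨rfl, by simp [← mul_assoc, hφ.one_mul_one_eq ha hb hc]⟩

theorem IsCocycle.mk_eq_mk_iff (hφ : IsCocycle U φ) {z w : Tot U G} :
    Quot.mk (rel U φ) z = Quot.mk (rel U φ) w ↔ rel U φ z w :=
  Quot.eq.trans hφ.equivalence_rel.eqvGen_iff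

theorem IsCocycle.rel_smul (hφ : IsCocycle U φ) {γ : Γ} {z w : Tot U G} (h : rel U φ z w)
    {b c : ι} (hb : γ • (z.2.1 : X) ∈ U b) (hc : γ • (w.2.1 : X) ∈ U c) :
    rel U φ ⟨b, ⟨γ • (z.2.1 : X), hb⟩, φ b z.1 γ z.2.1 * γ • z.2.2⟩
      ⟨c, ⟨γ • (w.2.1 : X), hc⟩, φ c w.1 γ w.2.1 * γ • w.2.2⟩ := by
  obtain ⟨a, ⟨x, ha⟩, g⟩ := z
  obtain ⟨a', ⟨y, ha'⟩, g'⟩ := w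
  obtain ⟨hxy, hg⟩ := h
  dsimp only at hxy hg hb hc
  subst hxy hg
  exact ⟨rfl, by
    simp [smul_mul', ← mul_assoc, hφ.one_mul_eq ha hb hc, hφ.mul_smul_one_eq ha ha' hc]⟩

/-- The left `Γ`-action on `P^φ`, computed with a chosen chart around each point. -/
noncomputable def pbActΓ (hU : ∀ x : X, ∃ a, x ∈ U a) (hφ : IsCocycle U φ) (γ : Γ) :
    PB U φ → PB U φ :=
  Quot.lift
    (fun z => Quot.mk (rel U φ) ⟨(hU (γ • (z.2.1 : X))).choose,
      ⟨γ • (z.2.1 : X), (hU (γ • (z.2.1 : X))).choose_spec⟩,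
      φ (hU (γ • (z.2.1 : X))).choose z.1 γ z.2.1 * γ • z.2.2⟩)
    (fun _ _ h => Quot.sound (hφ.rel_smul h _ _))

theorem pbActSpec_pbActΓ (hU : ∀ x : X, ∃ a, x ∈ U a) (hφ : IsCocycle U φ) :
    pbActSpec U φ (pbActΓ hU hφ) := fun γ a x hx g _ hb =>
  Quot.sound (hφ.rel_smul (γ := γ) (hφ.equivalence_rel.refl ⟨a, ⟨x, hx⟩, g⟩) _ hb)

theorem pbActSpec.one_act {act : Γ → PB U φ → PB U φ} (hact : pbActSpec U φ act)
    (hφ : IsCocycle U φ) (q : PB U φ) : act 1 q = q := by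
  obtain ⟨⟨a, ⟨x, hx⟩, g⟩⟩ := q
  refine (hact 1 a x hx g a (by simpa using hx)).trans (hφ.mk_eq_mk_iff.2 ⟨one_smul Γ x, ?_⟩)
  simp [hφ.1 a x hx]

theorem pbActSpec.act_act {act : Γ → PB U φ → PB U φ} (hact : pbActSpec U φ act)
    (hU : ∀ x : X, ∃ a, x ∈ U a) (hφ : IsCocycle U φ) (γ' γ : Γ) (q : PB U φ) :
    act γ' (act γ q) = act (γ' * γ) q := by
  obtain ⟨⟨a, ⟨x, hx⟩, g⟩⟩ := q
  obtain ⟨b, hb⟩ := hU (γ • x)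
  obtain ⟨c, hc⟩ := hU ((γ' * γ) • x)
  have hc' : γ' • γ • x ∈ U c := by rwa [← mul_smul]
  refine (congrArg (act γ') (hact γ a x hx g b hb)).trans ((hact γ' b _ hb _ c hc').trans
    (Eq.trans ?_ (hact (γ' * γ) a x hx g c hc).symm))
  congr 3
  · exact Subtype.ext (mul_smul γ' γ x).symm
  · rw [hφ.2 γ' γ a b c x hx hb hc, smul_mul', mul_smul, mul_assoc]

theorem pbActSpec.pbProj_act {act : Γ → PB U φ → PB U φ} (hact : pbActSpec U φ act)
    (hU : ∀ x : X, ∃ a, x ∈ U a) (γ : Γ) (q : PB U φ) :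
    pbProj (act γ q) = γ • pbProj q := by
  obtain ⟨⟨a, ⟨x, hx⟩, g⟩⟩ := q
  obtain ⟨b, hb⟩ := hU (γ • x)
  exact congrArg pbProj (hact γ a x hx g b hb)

theorem pbActSpec.act_pbActG {act : Γ → PB U φ → PB U φ} (hact : pbActSpec U φ act)
    (hU : ∀ x : X, ∃ a, x ∈ U a) (γ : Γ) (g' : G) (q : PB U φ) :
    act γ (pbActG g' q) = pbActG (γ • g') (act γ q) := by
  obtain ⟨⟨a, ⟨x, hx⟩, g⟩⟩ := q
  obtain ⟨b, hb⟩ := hU (γ • x)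
  refine (hact γ a x hx (g * g') b hb).trans
    (Eq.trans ?_ (congrArg (pbActG (γ • g')) (hact γ a x hx g b hb)).symm)
  rw [smul_mul', ← mul_assoc]
  rfl

theorem IsCocycle.existsUnique_pbActG_eq (hφ : IsCocycle U φ) (q q' : PB U φ)
    (h : pbProj q = pbProj q') : ∃! g : G, pbActG g q = q' := by
  obtain ⟨⟨a, ⟨x, ha⟩, g⟩⟩ := q
  obtain ⟨⟨b, ⟨y, hb⟩, k⟩⟩ := q'
  obtain rfl : x = y := h
  have key (g' : G) : pbActG g' (Quot.mk (rel U φ) ⟨a, ⟨x, ha⟩, g⟩) =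
      Quot.mk (rel U φ) ⟨b, ⟨x, hb⟩, k⟩ ↔ k = φ b a 1 x * (g * g') :=
    hφ.mk_eq_mk_iff.trans (and_iff_right rfl)
  refine ⟨(φ b a 1 x * g)⁻¹ * k, (key _).2 (by group), fun g' hg' => ?_⟩
  rw [(key g').1 hg']
  group

end Reconstruction

/-- reconstruction of a semi-equivariant principal bundle from a
transition cocycle: the gluing relation is an equivalence relation, the
formula for the Γ-action is well defined on the quotient and is a group
action, and the quotient is a semi-equivariant principal `(G,θ)`-bundle. -/
theorem statement8 {Γ X G ι : Type*} [Group Γ] [MulAction Γ X] [Group G]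
    [MulDistribMulAction Γ G] (U : ι → Set X) (hU : ∀ x : X, ∃ a, x ∈ U a)
    (φ : ι → ι → Γ → X → G) (hφ : IsCocycle U φ) :
    Equivalence (rel U φ) ∧
    (∃ act : Γ → PB U φ → PB U φ, pbActSpec U φ act ∧
      (∀ q, act 1 q = q) ∧
      (∀ γ' γ q, act γ' (act γ q) = act (γ' * γ) q) ∧
      (∀ γ q, pbProj (act γ q) = γ • pbProj q) ∧
      (∀ (γ : Γ) (g : G) (q : PB U φ),
        act γ (pbActG g q) = pbActG (γ • g) (act γ q))) ∧
    Function.Surjective (pbProj (U := U) (φ := φ)) ∧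
    (∀ q q' : PB U φ, pbProj q = pbProj q' → ∃! g : G, pbActG g q = q') ∧
    (∀ q : PB U φ, pbActG (1 : G) q = q) ∧
    (∀ (g g' : G) (q : PB U φ), pbActG g' (pbActG g q) = pbActG (g * g') q) ∧
    (∀ (g : G) (q : PB U φ), pbProj (pbActG g q) = pbProj q) := by
  have hact := pbActSpec_pbActΓ hU hφ
  exact ⟨hφ.equivalence_rel,
    ⟨pbActΓ hU hφ, hact, hact.one_act hφ, hact.act_act hU hφ, hact.pbProj_act hU,
      hact.act_pbActG hU⟩,
    pbProj_surjective hU, hφ.existsUnique_pbActG_eq, pbActG_one, pbActG_pbActG, pbProj_pbActG⟩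

end SemiDD
end

section
/- Let P be a Γ-semi-equivariant principal (G,θ)-bundle over a left Γ-set X, let s = {s_a : U_a → P} be sections over a cover U = {U_a}_{a∈A}, let φ be the transition cocycle determined by γ·s_a(x) = s_b(γ·x)·φ_{ba}(γ,x), and let P^φ be the bundle constructed from φ (the quotient of ⨆_a {a} × U_a × G by (a,x,g) ~ (b,x,φ_{ba}(1,x)g), with γ·[a,x,g] = [b,γ·x,φ_{ba}(γ,x)(γ·g)] and [a,x,g]·g′ = [a,x,gg′]). For p ∈ P and a with π(p) ∈ U_a, let T_a(p) ∈ G be the unique element with p = s_a(π(p))·T_a(p). Then the map P → P^φ sending p to [a, π(p), T_a(p)] (for any a with π(p) ∈ U_a) is well defined independently of a, bijective, commutes with the projections, is right G-equivariant, and is Γ-equivariant. In particular P and P^φ are isomorphic Γ-semi-equivariant principal (G,θ)-bundles. -/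
namespace SemiDD

theorem SEBundle.actG_injective {Γ X G : Type*} [Group Γ] [MulAction Γ X] [Group G]
    [MulDistribMulAction Γ G] (B : SEBundle Γ X G) (p : B.P) :
    Function.Injective (B.actG p) := fun g _ h =>
  (B.freeTrans p (B.actG p g) (B.π_actG p g).symm).unique rfl h.symm

/-- The transition functions at the identity of `Γ` compare the local sections. -/
theorem SEBundle.section_eq_actG_transition {Γ X G ι : Type*} [Group Γ] [MulAction Γ X]
    [Group G] [MulDistribMulAction Γ G] (B : SEBundle Γ X G) {U : ι → Set X}
    {s : ∀ (a : ι) (x : X), x ∈ U a → B.P} {φ : ι → ι → Γ → X → G}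
    (hφ : ∀ (γ : Γ) (a b : ι) (x : X) (hx : x ∈ U a) (hb : γ • x ∈ U b),
      B.actΓ γ (s a x hx) = B.actG (s b (γ • x) hb) (φ b a γ x))
    {a b : ι} {x : X} (hx : x ∈ U a) (hb : x ∈ U b) :
    s a x hx = B.actG (s b x hb) (φ b a 1 x) := by
  have h := hφ 1 a b x hx (by rwa [one_smul])
  simpa only [B.actΓ_one, one_smul] using h

/-- The map `P^φ → P`, `[a,x,g] ↦ s_a(x)·g`. -/
def SEBundle.ofPB {Γ X G ι : Type*} [Group Γ] [MulAction Γ X] [Group G]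
    [MulDistribMulAction Γ G] (B : SEBundle Γ X G) {U : ι → Set X}
    {s : ∀ (a : ι) (x : X), x ∈ U a → B.P} {φ : ι → ι → Γ → X → G}
    (hφ : ∀ (γ : Γ) (a b : ι) (x : X) (hx : x ∈ U a) (hb : γ • x ∈ U b),
      B.actΓ γ (s a x hx) = B.actG (s b (γ • x) hb) (φ b a γ x)) :
    PB U φ → B.P :=
  Quot.lift (fun z => B.actG (s z.1 z.2.1 z.2.1.2) z.2.2) (by
    rintro ⟨a, ⟨x, hx⟩, g⟩ ⟨b, ⟨y, hy⟩, k⟩ ⟨hxy, hk⟩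
    dsimp only at hxy hk ⊢
    subst hxy hk
    rw [B.section_eq_actG_transition hφ hx hy, B.actG_mul])

/-- a semi-equivariant principal bundle is isomorphic to the
bundle reconstructed from its transition cocycle, via `p ↦ [a, π(p), T_a(p)]`. -/
theorem statement10 {Γ X G ι : Type*} [Group Γ] [MulAction Γ X] [Group G]
    [MulDistribMulAction Γ G] (B : SEBundle Γ X G) (U : ι → Set X)
    (hU : ∀ x : X, ∃ a, x ∈ U a)
    (s : ∀ (a : ι) (x : X), x ∈ U a → B.P)
    (hs : ∀ (a : ι) (x : X) (hx : x ∈ U a), B.π (s a x hx) = x)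
    (φ : ι → ι → Γ → X → G)
    (hφ : ∀ (γ : Γ) (a b : ι) (x : X) (hx : x ∈ U a) (hb : γ • x ∈ U b),
      B.actΓ γ (s a x hx) = B.actG (s b (γ • x) hb) (φ b a γ x))
    (T : ι → B.P → G)
    (hT : ∀ (a : ι) (p : B.P) (h : B.π p ∈ U a),
      p = B.actG (s a (B.π p) h) (T a p)) :
    ∃ f : B.P → PB U φ,
      (∀ (p : B.P) (a : ι) (h : B.π p ∈ U a),
        f p = Quot.mk (rel U φ) ⟨a, ⟨⟨B.π p, h⟩, T a p⟩⟩) ∧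
      Function.Bijective f ∧
      (∀ p, pbProj (f p) = B.π p) ∧
      (∀ (p : B.P) (g : G), f (B.actG p g) = pbActG g (f p)) ∧
      (∀ act, pbActSpec U φ act →
        ∀ (γ : Γ) (p : B.P), f (B.actΓ γ p) = act γ (f p)) := by
  choose c hc using hU
  have key : ∀ (p : B.P) (a : ι) (h : B.π p ∈ U a),
      (Quot.mk (rel U φ) ⟨c (B.π p), ⟨⟨B.π p, hc _⟩, T (c (B.π p)) p⟩⟩ : PB U φ) =
        Quot.mk (rel U φ) ⟨a, ⟨⟨B.π p, h⟩, T a p⟩⟩ := by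
    refine fun p a h => Quot.sound ⟨rfl, B.actG_injective (s a (B.π p) h) ?_⟩
    dsimp only
    rw [← hT a p h, ← B.actG_mul, ← B.section_eq_actG_transition hφ (hc _) h, ← hT]
  let f : B.P → PB U φ := fun p =>
    Quot.mk (rel U φ) ⟨c (B.π p), ⟨⟨B.π p, hc _⟩, T (c (B.π p)) p⟩⟩
  have f_section : ∀ (a : ι) (x : X) (hx : x ∈ U a) (g : G),
      f (B.actG (s a x hx) g) = Quot.mk (rel U φ) ⟨a, ⟨⟨x, hx⟩, g⟩⟩ := by
    intro a x hx g
    obtain ⟨p, hp⟩ : ∃ p, p = B.actG (s a x hx) g := ⟨_, rfl⟩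
    have hπ : B.π p = x := by rw [hp, B.π_actG, hs]
    subst hπ
    have hg : T a p = g := B.actG_injective (s a (B.π p) hx) (by rw [← hT, ← hp])
    rw [← hp, ← hg]
    exact key p a hx
  refine ⟨f, key, ⟨?_, ?_⟩, fun p => rfl, fun p g => ?_, fun act hact γ p => ?_⟩
  · have hinv : Function.LeftInverse (B.ofPB hφ) f := fun p => (hT _ p (hc _)).symm
    exact hinv.injective
  · rintro ⟨a, ⟨x, hx⟩, g⟩
    exact ⟨_, f_section a x hx g⟩
  · have hp := congrArg (B.actG · g) (hT _ p (hc _))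
    rw [hp, B.actG_mul, f_section]
    rfl
  · have hp := congrArg (B.actΓ γ) (hT _ p (hc _))
    rw [hp, B.semi, hφ γ _ (c (γ • B.π p)) _ _ (hc _), B.actG_mul, f_section]
    exact (hact γ _ _ _ _ _ _).symm

end SemiDD
end

section
/- Let (G,θ) be an abelian Γ-group, U = {U_a}_{a∈A} a cover of a left Γ-set X, and V = {V_b}_{b∈B} a cover of X refining U via two refining maps r, s : B → A (so V_b ⊆ U_{r(b)} and V_b ⊆ U_{s(b)} for all b ∈ B). Define the restriction maps r_*, s_* : K^p_Γ(U,X,(G,θ)) → K^p_Γ(V,X,(G,θ)) by (r_*φ)_{(b_0,…,b_p)} := φ_{(r(b_0),…,r(b_p))} restricted to V_{(b_0,…,b_p)}, and similarly for s_*. Then r_* and s_* are chain maps, and for every p-cocycle φ ∈ K^p_Γ(U,X,(G,θ)) (i.e. ∂φ = 0), the difference s_*φ − r_*φ is a coboundary in K^p_Γ(V,X,(G,θ)). Consequently r_* and s_* induce the same homomorphism H^p_Γ(U,X,(G,θ)) → H^p_Γ(V,X,(G,θ)). -/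
namespace SemiDD

section Tuples

variable {Γ X : Type*} [Group Γ] {p : ℕ}

theorem ext_of_lt {G : Type*} [One G] {n : ℕ} (f : Fin n → G) {m : ℕ} (h : m < n) :
    ext f m = f ⟨m, h⟩ := dif_pos h

theorem ext_degen (z : (Fin p → Γ) × X) (j : ℕ) {k : ℕ} (hk : k < p + 1) :
    ext (degen j z).1 k = if k < j then ext z.1 k else if k = j then 1 else ext z.1 (k - 1) :=
  ext_of_lt _ hk

theorem prod_ext_of_ext {z w : (Fin p → Γ) × X} (h : ∀ k < p, ext z.1 k = ext w.1 k)
    (h' : z.2 = w.2) : z = w :=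
  Prod.ext (funext fun k => by simpa [ext_of_lt _ k.2] using h k k.2) h'

end Tuples

section Twist

variable {Γ X G : Type*} [Group Γ]

theorem twist_zpow [Group G] [MulDistribMulAction Γ G] {p : ℕ} (i : ℕ) (z : (Fin p → Γ) × X)
    (g : G) (m : ℤ) : twist i z (g ^ m) = twist i z g ^ m := by
  simp only [twist]
  split_ifs
  · exact smul_zpow' _ _ _
  · rfl

theorem twist_prod [CommGroup G] [MulDistribMulAction Γ G] {p : ℕ} (i : ℕ)
    (z : (Fin p → Γ) × X) {α : Type*} (t : Finset α) (f : α → G) :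
    twist i z (∏ j ∈ t, f j) = ∏ j ∈ t, twist i z (f j) := by
  simp only [twist]
  split_ifs
  · exact Finset.smul_prod'
  · rfl

theorem twist_degen_self [Group G] [MulDistribMulAction Γ G] {p : ℕ} (j : ℕ)
    (z : (Fin p → Γ) × X) (g : G) : twist j (degen j z) g = g := by
  simp only [twist, degen, ext]
  split_ifs <;> simp_all

theorem twist_succ [Group G] [MulDistribMulAction Γ G] {p : ℕ} (j : ℕ)
    (z : (Fin p → Γ) × X) (g : G) : twist (j + 1) z g = g := by
  simp [twist]

theorem twist_degen_succ [Group G] [MulDistribMulAction Γ G] {p : ℕ} (i j : ℕ)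
    (z : (Fin (p + 1) → Γ) × X) (g : G) : twist i (degen (j + 1) z) g = twist i z g := by
  simp [twist, degen, ext]

end Twist

section Simplicial

variable {Γ X : Type*} [Group Γ] [MulAction Γ X] {p : ℕ}

theorem pt_last (z : (Fin p → Γ) × X) : pt z p = z.2 := by
  simp [pt, List.drop_eq_nil_of_le]

theorem pt_eq_smul (z : (Fin p → Γ) × X) {k : ℕ} (hk : k < p) :
    pt z k = ext z.1 k • pt z (k + 1) := by
  have h : (List.range p).drop k = k :: (List.range p).drop (k + 1) := by
    rw [List.drop_eq_getElem_cons (by simpa using hk)]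
    simp
  simp [pt, h, mul_smul]

theorem pt_face (z : (Fin (p + 1) → Γ) × X) {i : ℕ} (hi : i ≤ p + 1) {k : ℕ} (hk : k ≤ p) :
    pt (face i z) k = pt z (if k < i then k else k + 1) := by
  induction hk using Nat.decreasingInduction with
  | self =>
    rw [pt_last]
    by_cases h : i = p + 1
    · subst h
      rw [if_pos (Nat.lt_succ_self p), pt_eq_smul z (Nat.lt_succ_self p), pt_last]
      simp [face]
    · rw [if_neg (by omega), pt_last]
      simp [face, h]
  | of_succ k hk ih =>
    rw [pt_eq_smul _ hk, ih, ext_of_lt _ hk]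
    rcases lt_trichotomy (k + 1) i with h | h | h
    · rw [if_pos h, if_pos (by omega), pt_eq_smul z (by omega : k < p + 1)]
      simp [face, h]
    · rw [if_neg (by omega), if_pos (by omega), pt_eq_smul z (by omega : k < p + 1),
        pt_eq_smul z (by omega : k + 1 < p + 1)]
      simp [face, h, mul_smul]
    · rw [if_neg (by omega), if_neg (by omega), pt_eq_smul z (by omega : k + 1 < p + 1)]
      simp [face, h.ne', h.not_gt]

theorem pt_degen (z : (Fin p → Γ) × X) {j : ℕ} (hj : j ≤ p) {k : ℕ} (hk : k ≤ p + 1) :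
    pt (degen j z) k = pt z (if k ≤ j then k else k - 1) := by
  induction hk using Nat.decreasingInduction with
  | self =>
    rw [pt_last, if_neg (by omega), Nat.add_sub_cancel, pt_last]
    rfl
  | of_succ k hk ih =>
    rw [pt_eq_smul _ hk, ih, ext_of_lt _ hk]
    rcases lt_trichotomy k j with h | h | h
    · rw [if_pos (by omega), if_pos (by omega), pt_eq_smul z (by omega : k < p)]
      simp [degen, h]
    · rw [if_neg (by omega), if_pos (by omega)]
      simp [degen, h]
    · obtain ⟨k, rfl⟩ : ∃ m, k = m + 1 := ⟨k - 1, by omega⟩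
      rw [if_neg (by omega), if_neg (by omega)]
      simp only [Nat.add_sub_cancel]
      rw [pt_eq_smul z (by omega : k < p)]
      simp [degen, h.ne', h.not_gt]

theorem ext_face (z : (Fin (p + 1) → Γ) × X) (i : ℕ) {k : ℕ} (hk : k < p) :
    ext (face i z).1 k = if k + 1 < i then ext z.1 k
      else if k + 1 = i then ext z.1 k * ext z.1 (k + 1) else ext z.1 (k + 1) :=
  ext_of_lt _ hk

theorem face_degen_of_lt (z : (Fin (p + 1) → Γ) × X) {i j : ℕ} (hij : i < j + 1) (hj : j ≤ p) :
    face i (degen (j + 1) z) = degen j (face i z) := by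
  refine prod_ext_of_ext (fun k hk => ?_) ?_
  · rw [ext_face _ _ hk, ext_degen _ _ hk, ext_degen _ _ (by omega), ext_degen _ _ (by omega)]
    by_cases hkp : k < p
    · rw [ext_face _ _ hkp, ext_face _ _ (by omega)]
      grind
    · rcases k with _ | k
      · grind
      · rw [Nat.add_sub_cancel, ext_face _ _ (by omega : k < p)]
        grind
  · simp [face, degen, show i ≠ p + 1 + 1 by omega, show i ≠ p + 1 by omega]

theorem face_degen_self (z : (Fin p → Γ) × X) {j : ℕ} (hj : j ≤ p) :
    face j (degen j z) = z := by
  refine prod_ext_of_ext (fun k hk => ?_) ?_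
  · rw [ext_face _ _ hk, ext_degen _ _ (by omega), ext_degen _ _ (by omega)]
    grind
  · simp [face, degen, show j ≠ p + 1 by omega]

theorem face_succ_degen (z : (Fin p → Γ) × X) (j : ℕ) :
    face (j + 1) (degen j z) = z := by
  refine prod_ext_of_ext (fun k hk => ?_) ?_
  · rw [ext_face _ _ hk, ext_degen _ _ (by omega), ext_degen _ _ (by omega)]
    grind
  · simp +contextual [face, degen, ext]

theorem face_degen_of_gt (z : (Fin (p + 1) → Γ) × X) {i j : ℕ} (hij : j < i) (hi : i ≤ p + 1) :
    face (i + 1) (degen j z) = degen j (face i z) := by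
  refine prod_ext_of_ext (fun k hk => ?_) ?_
  · rw [ext_face _ _ hk, ext_degen _ _ hk, ext_degen _ _ (by omega), ext_degen _ _ (by omega)]
    by_cases hkp : k < p
    · rw [ext_face _ _ hkp]
      rcases k with _ | k
      · grind
      · rw [Nat.add_sub_cancel, ext_face _ _ (by omega : k < p)]
        grind
    · rcases k with _ | k
      · grind
      · rw [Nat.add_sub_cancel, ext_face _ _ (by omega : k < p)]
        grind
  · change (if i + 1 = p + 1 + 1 then ext (degen j z).1 (p + 1) • z.2 else z.2) =
      if i = p + 1 then ext z.1 p • z.2 else z.2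
    rw [ext_degen _ _ (by omega)]
    grind

end Simplicial

section Prism

variable {ι κ : Type*} (r s : κ → ι) {n : ℕ}

/-- The index tuple `(r b_0, …, r b_j, s b_j, …, s b_n)`. -/
def prism (j : ℕ) (b : Fin (n + 1) → κ) : Fin (n + 2) → ι :=
  fun k => if (k : ℕ) ≤ j then r (b ⟨min k n, by omega⟩) else s (b ⟨k - 1, by omega⟩)

theorem faceIdx_prism_of_lt (b : Fin (n + 2) → κ) {i j : ℕ} (hij : i < j + 1) (hj : j ≤ n) :
    faceIdx i (prism r s (j + 1) b) = prism r s j (faceIdx i b) := by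
  funext k
  have := k.2
  simp only [faceIdx, prism, Fin.val_castSucc, Fin.val_succ]
  split_ifs <;> first | omega | rfl | (congr 2; ext; simp <;> omega)

theorem faceIdx_prism_of_gt (b : Fin (n + 2) → κ) {i j : ℕ} (hij : j < i) (hi : i ≤ n + 1) :
    faceIdx (i + 1) (prism r s j b) = prism r s j (faceIdx i b) := by
  funext k
  have := k.2
  simp only [faceIdx, prism, Fin.val_castSucc, Fin.val_succ]
  split_ifs <;> first | omega | rfl | (congr 2; ext; simp; omega)

theorem faceIdx_succ_prism_succ (b : Fin (n + 1) → κ) (j : ℕ) :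
    faceIdx (j + 1) (prism r s (j + 1) b) = faceIdx (j + 1) (prism r s j b) := by
  funext k
  simp only [faceIdx, prism, Fin.val_castSucc, Fin.val_succ]
  split_ifs <;> first | omega | rfl

theorem faceIdx_zero_prism_zero (b : Fin (n + 1) → κ) :
    faceIdx 0 (prism r s 0 b) = fun k => s (b k) := by
  funext k
  simp [faceIdx, prism]

theorem faceIdx_last_prism_last (b : Fin (n + 1) → κ) :
    faceIdx (n + 1) (prism r s n b) = fun k => r (b k) := by
  funext k
  have := k.2
  simp only [faceIdx, prism, Fin.val_castSucc]
  rw [if_pos this, if_pos (by omega)]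
  congr 2
  ext
  simp
  omega

end Prism

section Membership

variable {Γ X ι κ : Type*} [Group Γ] [MulAction Γ X]

theorem face_mem_tupSet {U : ι → Set X} {p : ℕ} {a : Fin (p + 2) → ι}
    {z : (Fin (p + 1) → Γ) × X} (hz : z ∈ tupSet U a) {i : ℕ} (hi : i ≤ p + 1) :
    face i z ∈ tupSet U (faceIdx i a) := by
  intro k
  rw [pt_face z hi (by omega)]
  simp only [faceIdx]
  split_ifs
  · exact hz k.castSucc
  · exact hz k.succ

theorem degen_mem_tupSet_prism {U : ι → Set X} {V : κ → Set X} {r s : κ → ι}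
    (hr : ∀ b, V b ⊆ U (r b)) (hs : ∀ b, V b ⊆ U (s b)) {p : ℕ} {b : Fin (p + 1) → κ}
    {z : (Fin p → Γ) × X} (hz : z ∈ tupSet V b) {j : ℕ} (hj : j ≤ p) :
    degen j z ∈ tupSet U (prism r s j b) := by
  intro k
  rw [pt_degen z hj (by omega)]
  simp only [prism]
  split_ifs with h
  · have := hz ⟨min k p, by omega⟩
    simp only [min_eq_left (h.trans hj)] at this
    simpa only [min_eq_left (h.trans hj)] using hr _ this
  · exact hs _ (hz ⟨k - 1, by omega⟩)

end Membership

section Cochains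

variable {Γ X ι κ G : Type*} [Group Γ] [MulAction Γ X]

open Classical in
/-- Extension of a cochain by `1` to all of `X^p`. -/
noncomputable def extendOne [Group G] {U : ι → Set X} {p : ℕ} (φ : K Γ U G p)
    (a : Fin (p + 1) → ι) (z : (Fin p → Γ) × X) : G :=
  if h : z ∈ tupSet (Γ := Γ) U a then φ a ⟨z, h⟩ else 1

theorem extendOne_of_mem [Group G] {U : ι → Set X} {p : ℕ} (φ : K Γ U G p)
    {a : Fin (p + 1) → ι} {z : (Fin p → Γ) × X} (h : z ∈ tupSet (Γ := Γ) U a) :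
    extendOne φ a z = φ a ⟨z, h⟩ := dif_pos h

theorem cob_apply [CommGroup G] [MulDistribMulAction Γ G] {U : ι → Set X} {p : ℕ}
    (φ : K Γ U G p) (a : Fin (p + 2) → ι) (z : tupSet (Γ := Γ) U a) :
    cob φ a z = ∏ i ∈ Finset.range (p + 2),
      twist i z.1 (extendOne φ (faceIdx i a) (face i z.1)) ^ ((-1 : ℤ) ^ i) := by
  have : cob φ = ∏ i ∈ Finset.range (p + 2), tpb i φ ^ ((-1 : ℤ) ^ i) := rfl
  rw [this, Finset.prod_apply, Finset.prod_apply]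
  rfl

theorem res_cob [CommGroup G] [MulDistribMulAction Γ G] {U : ι → Set X} {V : κ → Set X}
    (r : κ → ι) (hr : ∀ b, V b ⊆ U (r b)) {p : ℕ} (φ : K Γ U G p) :
    res r hr (cob φ) = cob (res r hr φ) := by
  funext b z
  rw [cob_apply]
  simp only [res, cob_apply]
  refine Finset.prod_congr rfl fun i hi => ?_
  have hi : i ≤ p + 1 := by simpa [Nat.lt_succ_iff] using hi
  have hz := face_mem_tupSet z.2 hi
  have e : faceIdx i (fun k => r (b k)) = fun k => r (faceIdx i b k) := by
    funext k
    simp only [faceIdx]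
    split_ifs <;> rfl
  rw [extendOne_of_mem _ hz, e,
    extendOne_of_mem φ (a := fun k => r (faceIdx i b k)) fun k => hr _ (hz k)]
  rfl

end Cochains

/-- The cancellation pattern of the double alternating product of a prism operator. -/
theorem prod_prism_cancel {M : Type*} [CommGroup M] (T S : ℕ → ℕ → M) (D : ℕ → M) (n : ℕ)
    (hlt : ∀ i j, i < j + 1 → j ≤ n → T i (j + 1) = S i j)
    (hself : ∀ j ≤ n + 1, T j j = D j) (hsucc : ∀ j ≤ n + 1, T (j + 1) j = D (j + 1))
    (hgt : ∀ i j, j < i → i ≤ n + 1 → T (i + 1) j = S i j) :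
    (∏ j ∈ Finset.range (n + 2),
        (∏ i ∈ Finset.range (n + 3), T i j ^ ((-1 : ℤ) ^ i)) ^ ((-1 : ℤ) ^ j)) *
      ∏ i ∈ Finset.range (n + 2),
        (∏ j ∈ Finset.range (n + 1), S i j ^ ((-1 : ℤ) ^ j)) ^ ((-1 : ℤ) ^ i) =
    D 0 / D (n + 2) := by
  set a : ℕ → ℕ → M := fun i j => S i j ^ ((-1 : ℤ) ^ (i + j)) with ha
  have hrow : ∀ j ∈ Finset.range (n + 2),
      (∏ i ∈ Finset.range (n + 3), T i j ^ ((-1 : ℤ) ^ i)) ^ ((-1 : ℤ) ^ j) =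
      (∏ i ∈ Finset.range j, T i j ^ ((-1 : ℤ) ^ (i + j))) * (D j / D (j + 1)) *
        (∏ i ∈ Finset.Ico (j + 1) (n + 2), a i j)⁻¹ := by
    intro j hj
    have hj : j ≤ n + 1 := by simpa [Nat.lt_succ_iff] using hj
    simp only [← Finset.prod_zpow, ← zpow_mul, ← pow_add]
    rw [← Finset.prod_range_mul_prod_Ico _ (by omega : j + 2 ≤ n + 3),
      Finset.prod_range_succ, Finset.prod_range_succ, hself j hj, hsucc j hj,
      ← Finset.prod_Ico_add' _ (j + 1) (n + 2) 1, ← Finset.prod_inv_distrib]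
    have e1 : (-1 : ℤ) ^ (j + j) = 1 := Even.neg_one_pow ⟨j, rfl⟩
    have e2 : (-1 : ℤ) ^ (j + 1 + j) = -1 := Odd.neg_one_pow ⟨j, by ring⟩
    rw [e1, e2, zpow_one, zpow_neg_one, ← div_eq_mul_inv, mul_div_assoc]
    congr 1
    refine Finset.prod_congr rfl fun i hi => ?_
    rw [Finset.mem_Ico] at hi
    rw [hgt i j (by omega) (by omega), ha, ← zpow_neg]
    congr 1
    ring
  have hcol : ∏ i ∈ Finset.range (n + 2),
        (∏ j ∈ Finset.range (n + 1), S i j ^ ((-1 : ℤ) ^ j)) ^ ((-1 : ℤ) ^ i) =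
      ∏ j ∈ Finset.range (n + 1), ∏ i ∈ Finset.range (n + 2), a i j := by
    rw [Finset.prod_comm]
    simp only [← Finset.prod_zpow, ← zpow_mul, ← pow_add, ha]
    simp only [add_comm]
  have hlow : ∏ j ∈ Finset.range (n + 2), ∏ i ∈ Finset.range j, T i j ^ ((-1 : ℤ) ^ (i + j)) =
      (∏ j ∈ Finset.range (n + 1), ∏ i ∈ Finset.range (j + 1), a i j)⁻¹ := by
    rw [Finset.prod_range_succ', Finset.prod_range_zero, mul_one, ← Finset.prod_inv_distrib]
    refine Finset.prod_congr rfl fun j hj => ?_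
    rw [← Finset.prod_inv_distrib]
    refine Finset.prod_congr rfl fun i hi => ?_
    rw [Finset.mem_range] at hi hj
    rw [hlt i j hi (by omega), ha, ← zpow_neg]
    congr 1
    ring
  rw [Finset.prod_congr rfl hrow, Finset.prod_mul_distrib, Finset.prod_mul_distrib, hlow,
    Finset.prod_range_div', Finset.prod_inv_distrib,
    Finset.prod_range_succ (fun j => ∏ i ∈ Finset.Ico (j + 1) (n + 2), a i j),
    Finset.Ico_self, Finset.prod_empty, mul_one, hcol]
  have : ∏ j ∈ Finset.range (n + 1), ∏ i ∈ Finset.range (n + 2), a i j =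
      (∏ j ∈ Finset.range (n + 1), ∏ i ∈ Finset.range (j + 1), a i j) *
        ∏ j ∈ Finset.range (n + 1), ∏ i ∈ Finset.Ico (j + 1) (n + 2), a i j := by
    rw [← Finset.prod_mul_distrib]
    refine Finset.prod_congr rfl fun j hj => ?_
    rw [Finset.mem_range] at hj
    rw [Finset.prod_range_mul_prod_Ico _ (by omega : j + 1 ≤ n + 2)]
  rw [this]
  simp [mul_assoc, mul_comm, mul_left_comm]

section Homotopy

variable {Γ X ι κ G : Type*} [Group Γ] [MulAction Γ X] [CommGroup G] {U : ι → Set X}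
  {V : κ → Set X}

/-- The prism operator `K^{p+1}(U) → K^p(V)` attached to two refining maps. -/
noncomputable def prismOp (V : κ → Set X) (r s : κ → ι) {p : ℕ} (φ : K Γ U G (p + 1)) :
    K Γ V G p :=
  fun b z => ∏ j ∈ Finset.range (p + 1),
    extendOne φ (prism r s j b) (degen j z.1) ^ ((-1 : ℤ) ^ j)

variable {r s : κ → ι}

theorem res_eq_extendOne (hr : ∀ b, V b ⊆ U (r b)) {p : ℕ} (φ : K Γ U G p)
    (b : Fin (p + 1) → κ) (z : tupSet (Γ := Γ) V b) :
    res r hr φ b z = extendOne φ (fun k => r (b k)) z.1 :=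
  (extendOne_of_mem φ (a := fun k => r (b k)) fun k => hr _ (z.2 k)).symm

variable [MulDistribMulAction Γ G]

theorem res_eq_of_cob_eq_one (hr : ∀ b, V b ⊆ U (r b)) (hs : ∀ b, V b ⊆ U (s b))
    (φ : K Γ U G 0) (hφ : cob φ = 1) : res s hs φ = res r hr φ := by
  funext b z
  have h := cob_apply φ _ ⟨_, degen_mem_tupSet_prism hr hs z.2 le_rfl⟩
  rw [hφ, Finset.prod_range_succ, Finset.prod_range_one, twist_degen_self, twist_succ,
    face_degen_self _ le_rfl, face_succ_degen, faceIdx_zero_prism_zero,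
    faceIdx_last_prism_last] at h
  rw [res_eq_extendOne, res_eq_extendOne]
  exact div_eq_one.1 (by simpa [← div_eq_mul_inv] using h.symm)

theorem res_mul_inv_res_eq_cob (hr : ∀ b, V b ⊆ U (r b)) (hs : ∀ b, V b ⊆ U (s b)) {p : ℕ}
    (φ : K Γ U G (p + 1)) (hφ : cob φ = 1) :
    res s hs φ * (res r hr φ)⁻¹ = cob (prismOp V r s φ) := by
  funext b z
  have key := prod_prism_cancel
    (fun i j => twist i (degen j z.1)
      (extendOne φ (faceIdx i (prism r s j b)) (face i (degen j z.1))))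
    (fun i j => twist i z.1 (extendOne φ (prism r s j (faceIdx i b)) (degen j (face i z.1))))
    (fun j => extendOne φ
      (if j = 0 then fun k => s (b k) else faceIdx j (prism r s (j - 1) b)) z.1) p
    (fun i j hij hj => by
      simp only [twist_degen_succ, faceIdx_prism_of_lt r s b hij hj, face_degen_of_lt z.1 hij hj])
    (fun j hj => by
      simp only [twist_degen_self, face_degen_self z.1 hj]
      rcases j with _ | j
      · simp [faceIdx_zero_prism_zero]
      · simp [faceIdx_succ_prism_succ r s b j])
    (fun j hj => by simp [twist_succ, face_succ_degen z.1])
    (fun i j hij hi => by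
      obtain ⟨i, rfl⟩ : ∃ m, i = m + 1 := ⟨i - 1, by omega⟩
      simp only [twist_succ, faceIdx_prism_of_gt r s b hij hi, face_degen_of_gt z.1 hij hi])
  have hone : ∀ j ∈ Finset.range (p + 2), (∏ i ∈ Finset.range (p + 3), twist i (degen j z.1)
      (extendOne φ (faceIdx i (prism r s j b)) (face i (degen j z.1))) ^ ((-1 : ℤ) ^ i)) ^
        ((-1 : ℤ) ^ j) = 1 := by
    intro j hj
    have hj : j ≤ p + 1 := by simpa [Nat.lt_succ_iff] using hj
    rw [← cob_apply φ _ ⟨_, degen_mem_tupSet_prism hr hs z.2 hj⟩, hφ]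
    exact one_zpow _
  rw [Finset.prod_congr rfl hone, Finset.prod_const_one, one_mul] at key
  rw [if_pos rfl, if_neg (by omega), Nat.add_sub_cancel (n := p + 1) (m := 1),
    faceIdx_last_prism_last] at key
  rw [Pi.mul_apply, Pi.mul_apply, Pi.inv_apply, Pi.inv_apply, res_eq_extendOne,
    res_eq_extendOne, ← div_eq_mul_inv, ← key, cob_apply]
  refine Finset.prod_congr rfl fun i hi => ?_
  have hi : i ≤ p + 1 := by simpa [Nat.lt_succ_iff] using hi
  rw [extendOne_of_mem _ (face_mem_tupSet z.2 hi), prismOp, twist_prod]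
  simp only [twist_zpow]

end Homotopy

/-- for two refining maps `r, s` of a refinement `V` of the
cover `U`, the restriction maps `r_*, s_*` are chain maps, the difference
`s_*φ - r_*φ` of the restrictions of a cocycle is a coboundary (for cocycles
of degree `≥ 1`; in degree `0` the two restrictions agree), so `r_*` and `s_*`
induce the same map on semi-equivariant cohomology. -/
theorem statement11 {Γ X ι κ G : Type*} [Group Γ] [MulAction Γ X] [CommGroup G]
    [MulDistribMulAction Γ G] (U : ι → Set X) (V : κ → Set X)
    (hUc : ∀ x : X, ∃ a, x ∈ U a) (hVc : ∀ x : X, ∃ b, x ∈ V b)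
    (r s : κ → ι) (hr : ∀ b, V b ⊆ U (r b)) (hs : ∀ b, V b ⊆ U (s b)) :
    (∀ (p : ℕ) (φ : K Γ U G p), res r hr (cob φ) = cob (res r hr φ)) ∧
    (∀ (p : ℕ) (φ : K Γ U G p), res s hs (cob φ) = cob (res s hs φ)) ∧
    (∀ φ : K Γ U G 0, cob φ = 1 → res s hs φ = res r hr φ) ∧
    (∀ (p : ℕ) (φ : K Γ U G (p + 1)), cob φ = 1 →
      ∃ η : K Γ V G p, res s hs φ * (res r hr φ)⁻¹ = cob η) :=
  ⟨fun _ φ => res_cob r hr φ, fun _ φ => res_cob s hs φ,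
    fun φ hφ => res_eq_of_cob_eq_one hr hs φ hφ,
    fun _ φ hφ => ⟨prismOp V r s φ, res_mul_inv_res_eq_cob hr hs φ hφ⟩⟩

end SemiDD
end

section
/- Let 1 → A →α B →β C → 1 be a central extension of Γ-groups and U a cover of a left Γ-set X. Suppose ψ, ψ′ ∈ K^1_Γ(U,X,B) satisfy β ∘ ψ = β ∘ ψ′ = φ, where φ satisfies the 1-cocycle condition (δ_1φ)^{−1}(δ_2φ)(δ_0φ) = 1. Then ω := ψ′ψ^{−1} takes values in α(A), and if ω̄ ∈ K^1_Γ(U,X,A) is the unique cochain with α ∘ ω̄ = ω, and ν̄, ν̄′ ∈ K^2_Γ(U,X,A) are the unique cochains with α ∘ ν̄ = (δ_1ψ)^{−1}(δ_2ψ)(δ_0ψ) and α ∘ ν̄′ = (δ_1ψ′)^{−1}(δ_2ψ′)(δ_0ψ′), then ν̄′ = ν̄ + ∂ω̄. In particular [ν̄] = [ν̄′] in H^2_Γ(U,X,A). -/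
namespace SemiDD

/-- The twisted pullbacks are multiplicative. -/
theorem tpb_mul {Γ X ι G : Type*} [Group Γ] [MulAction Γ X] [Group G]
    [MulDistribMulAction Γ G] {U : ι → Set X} {p : ℕ} (i : ℕ) (φ χ : K Γ U G p) :
    tpb i (φ * χ) = tpb i φ * tpb i χ := by
  funext a z
  simp only [tpb, twist, Pi.mul_apply]
  split_ifs <;> simp [smul_mul']

/-- The twisted pullbacks commute with equivariant changes of coefficients. -/
theorem tpb_mapK {Γ X ι A B : Type*} [Group Γ] [MulAction Γ X] [Group A] [Group B]
    [MulDistribMulAction Γ A] [MulDistribMulAction Γ B] {U : ι → Set X} (α : A →* B)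
    (hα : ∀ (γ : Γ) (g : A), α (γ • g) = γ • α g) {p : ℕ} (i : ℕ) (φ : K Γ U A p) :
    tpb i (mapK (⇑α) φ) = mapK (⇑α) (tpb i φ) := by
  funext a z
  simp only [tpb, twist, mapK]
  split_ifs <;> simp [hα]

/-- The coboundary of a `1`-cochain as an explicit product. -/
theorem cob_one {Γ X ι G : Type*} [Group Γ] [MulAction Γ X] [Group G]
    [MulDistribMulAction Γ G] {U : ι → Set X} (φ : K Γ U G 1) :
    cob φ = tpb 0 φ * (tpb 1 φ)⁻¹ * tpb 2 φ := by
  simp [cob, List.range_succ, mul_assoc]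

/-- The dependence of `b₁⁻¹ b₂ b₀` on central factors. -/
theorem inv_mul_mul_of_central {A B : Type*} [Group A] [Group B] (α : A →* B)
    (hcentral : ∀ (x : A) (b : B), α x * b = b * α x) (x₀ x₁ x₂ : A) (b₀ b₁ b₂ : B) :
    (α x₁ * b₁)⁻¹ * (α x₂ * b₂) * (α x₀ * b₀) =
      b₁⁻¹ * b₂ * b₀ * α (x₀ * x₁⁻¹ * x₂) := by
  calc (α x₁ * b₁)⁻¹ * (α x₂ * b₂) * (α x₀ * b₀)
      = b₁⁻¹ * (α (x₁⁻¹ * x₂) * b₂) * (α x₀ * b₀) := by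
        simp only [mul_inv_rev, map_mul, map_inv, mul_assoc]
    _ = b₁⁻¹ * b₂ * (α (x₁⁻¹ * x₂) * (α x₀ * b₀)) := by
        rw [hcentral (x₁⁻¹ * x₂) b₂]
        simp only [mul_assoc]
    _ = b₁⁻¹ * b₂ * b₀ * α (x₀ * x₁⁻¹ * x₂) := by
        rw [← mul_assoc (α _), hcentral (x₁⁻¹ * x₂) (α x₀), ← map_mul, ← mul_assoc x₀,
          hcentral _ b₀]
        simp only [mul_assoc]

/-- the Dixmier–Douady 2-cocycle does not depend on the choice
of lift: two lifts `ψ, ψ'` of the same 1-cocycle differ by `ω` with values in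
`α(A)`, and the corresponding `A`-valued 2-cocycles differ by `∂ω̄`. -/
theorem statement16 {Γ X ι A B C : Type*} [Group Γ] [MulAction Γ X]
    [CommGroup A] [Group B] [Group C] [MulDistribMulAction Γ A]
    [MulDistribMulAction Γ B] [MulDistribMulAction Γ C]
    (U : ι → Set X) (α : A →* B) (β : B →* C)
    (hαΓ : ∀ (γ : Γ) (g : A), α (γ • g) = γ • α g)
    (hβΓ : ∀ (γ : Γ) (g : B), β (γ • g) = γ • β g)
    (hαinj : Function.Injective ⇑α)
    (hcentral : ∀ (x : A) (b : B), α x * b = b * α x)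
    (hβsurj : Function.Surjective ⇑β)
    (hexact : ∀ b : B, β b = 1 ↔ b ∈ Set.range ⇑α)
    (φ : K Γ U C 1) (hφcoc : (tpb 1 φ)⁻¹ * tpb 2 φ * tpb 0 φ = 1)
    (ψ ψ' : K Γ U B 1) (hψ : mapK (⇑β) ψ = φ) (hψ' : mapK (⇑β) ψ' = φ) :
    (∀ (a : Fin 2 → ι) (z : tupSet (Γ := Γ) U a),
      (ψ' * ψ⁻¹) a z ∈ Set.range ⇑α) ∧
    (∀ (ω : K Γ U A 1) (ν ν' : K Γ U A 2),
      mapK (⇑α) ω = ψ' * ψ⁻¹ →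
      mapK (⇑α) ν = (tpb 1 ψ)⁻¹ * tpb 2 ψ * tpb 0 ψ →
      mapK (⇑α) ν' = (tpb 1 ψ')⁻¹ * tpb 2 ψ' * tpb 0 ψ' →
      ν' = ν * cob ω) := by
  refine ⟨fun a z => ?_, fun ω ν ν' hω hν hν' => ?_⟩
  · have h : β (ψ a z) = β (ψ' a z) := congrFun (congrFun (hψ.trans hψ'.symm) a) z
    rw [← hexact]
    simp [h]
  · have hψω : ψ' = mapK (⇑α) ω * ψ := by rw [hω, inv_mul_cancel_right]
    funext a z
    apply hαinj
    have h := congrFun (congrFun hν a) z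
    have h' := congrFun (congrFun hν' a) z
    rw [hψω] at h'
    simp only [tpb_mul, tpb_mapK α hαΓ, Pi.mul_apply, Pi.inv_apply, mapK] at h h'
    rw [h', inv_mul_mul_of_central α hcentral, cob_one, ← h, ← map_mul]
    rfl

end SemiDD
end
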